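/- For every prime power q there exists an (8, M, 4, 4)_q constant dimension code with M = q^{12} + Gauss[4,2]_q · (q²+1) · q² + 1, i.e., a set of M four-dimensional subspaces of 𝔽_q^8 with pairwise subspace distance at least 4, containing an (8,4,2)_q lifted MRD code as a subcode; in particular A_q(8,4,4) ≥ q^{12} + Gauss[4,2]_q (q²+1) q² + 1. -/

import Mathlib

open Module Polynomial Matrix

variable (F : Type) [Field F] [Fintype F]

/-- `C` is a `[k × (n-k), (n-k)(k-δ+1), δ]_q` MRD (maximum rank distance) code:
an `F`-linear subspace of `k × (n-k)` matrices of dimension `(n-k)(k-δ+1)` in which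
every nonzero matrix has rank at least `δ`. -/
def IsMRD (n k δ : ℕ) (C : Submodule F (Matrix (Fin k) (Fin (n - k)) F)) : Prop :=
  Module.finrank F C = (n - k) * (k - δ + 1) ∧
    ∀ A : Matrix (Fin k) (Fin (n - k)) F, A ∈ C → A ≠ 0 → δ ≤ A.rank

/-- The matrix `[I_k | A]`. -/
def liftMatrix (n k : ℕ) (A : Matrix (Fin k) (Fin (n - k)) F) : Matrix (Fin k) (Fin n) F :=
  Matrix.of fun i j =>
    if h : (j : ℕ) < k then (if (i : ℕ) = (j : ℕ) then 1 else 0)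
    else A i ⟨(j : ℕ) - k, by have := j.isLt; omega⟩

/-- The lifting of the matrix `A`: the row space of `[I_k | A]`, a subspace of `F^n`. -/
def liftSubspace (n k : ℕ) (A : Matrix (Fin k) (Fin (n - k)) F) : Submodule F (Fin n → F) :=
  Submodule.span F (Set.range fun i => liftMatrix F n k A i)

/-- The lifted code of a rank-metric code `C`: the set of liftings of all codewords of `C`. -/
def liftedCode (n k : ℕ) (C : Submodule F (Matrix (Fin k) (Fin (n - k)) F)) :
    Set (Submodule F (Fin n → F)) :=
  {X | ∃ A ∈ C, X = liftSubspace F n k A}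

/-- The subspace distance `d_S(X,Y) = dim X + dim Y - 2 dim (X ⊓ Y)`. -/
noncomputable def subDist {n : ℕ} (X Y : Submodule F (Fin n → F)) : ℕ :=
  finrank F X + finrank F Y - 2 * finrank F (X ⊓ Y : Submodule F (Fin n → F))

/-- `L^{(n,k)}`: vectors of `F^n` whose first `k` coordinates are not all zero. -/
def Lset (n k : ℕ) : Set (Fin n → F) := {v | ∃ i : Fin n, (i : ℕ) < k ∧ v i ≠ 0}

/-- `V^n`: one-dimensional subspaces of `F^n` spanned by vectors of `L^{(n,k)}`. -/
def Vset (n k : ℕ) : Set (Submodule F (Fin n → F)) :=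
  {X | ∃ v ∈ Lset F n k, X = Submodule.span F {v}}

/-- Projection of a vector of `F^n` onto its first `k` coordinates. -/
def projK (n k : ℕ) (v : Fin n → F) : Fin k → F :=
  fun i => if h : (i : ℕ) < n then v ⟨(i : ℕ), h⟩ else 0

/-- `V_A^{(n,k)}`: one-dimensional subspaces of `F^n` spanned by vectors whose projection
onto the first `k` coordinates is a nonzero vector spanning `A`. -/
def VA (n k : ℕ) (A : Submodule F (Fin k → F)) : Set (Submodule F (Fin n → F)) :=
  {X | ∃ v : Fin n → F, projK F n k v ≠ 0 ∧ Submodule.span F {projK F n k v} = A ∧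
    X = Submodule.span F {v}}

/-- `A_q(n,d,k)`: the maximum size of an `(n, M, d, k)_q` constant dimension code, i.e. of a
set of `k`-dimensional subspaces of `F^n` whose pairwise subspace distances are at least `d`. -/
noncomputable def Aq (n d k : ℕ) : ℕ :=
  sSup {M | ∃ S : Set (Submodule F (Fin n → F)), S.Finite ∧ S.ncard = M ∧
    (∀ X ∈ S, finrank F X = k) ∧ ∀ X ∈ S, ∀ Y ∈ S, X ≠ Y → d ≤ subDist F X Y}

/-- The Gaussian coefficient `[n, k]_q`: the number of `k`-dimensional subspaces of `F^n`. -/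
noncomputable def gaussNat (n k : ℕ) : ℕ :=
  Nat.card {X : Submodule F (Fin n → F) // finrank F X = k}

/-- The dimension of a subspace of a product is at most the sum of the dimensions of its
projection to the first factor and of its intersection with the second factor. -/
theorem finrank_le_add_of_fst_mem {F V W : Type*} [Field F] [AddCommGroup V] [Module F V]
    [AddCommGroup W] [Module F W] [FiniteDimensional F V] [FiniteDimensional F W]
    (Z : Submodule F (V × W)) (A : Submodule F V) (B : Submodule F W)
    (hA : ∀ z ∈ Z, z.1 ∈ A) (hB : ∀ y, ((0 : V), y) ∈ Z → y ∈ B) :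
    finrank F Z ≤ finrank F A + finrank F B := by
  let f : Z →ₗ[F] A := ((LinearMap.fst F V W).comp Z.subtype).codRestrict A fun z => hA z z.2
  have h0 : ∀ z : LinearMap.ker f, z.1.1.1 = 0 := fun z => by
    have := z.2
    rw [LinearMap.mem_ker] at this
    exact congrArg Subtype.val this
  let g : LinearMap.ker f →ₗ[F] B :=
    ((LinearMap.snd F V W).comp (Z.subtype.comp (LinearMap.ker f).subtype)).codRestrict B
      fun z => hB _ (by
        have h := z.1.2
        rw [show ((z : Z) : V × W) = (0, z.1.1.2) from Prod.ext (h0 z) rfl] at h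
        exact h)
  have hg : Function.Injective g := by
    intro z z' h
    have h2 : z.1.1.2 = z'.1.1.2 := congrArg Subtype.val h
    exact Subtype.ext (Subtype.ext (Prod.ext ((h0 z).trans (h0 z').symm) h2))
  have h1 := LinearMap.finrank_range_add_finrank_ker f
  have h2 := LinearMap.finrank_le_finrank_of_injective hg
  have h3 := Submodule.finrank_le (LinearMap.range f)
  omega

theorem finrank_graph {F V W : Type*} [Field F] [AddCommGroup V] [Module F V]
    [AddCommGroup W] [Module F W] (f : V →ₗ[F] W) : finrank F f.graph = finrank F V := by
  rw [LinearMap.graph_eq_range_prod]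
  exact LinearMap.finrank_range_of_inj fun _ _ h => congrArg Prod.fst h

/-- The number of planes of a four-dimensional space. -/
theorem card_finrank_two {F V : Type*} [Field F] [Fintype F] [AddCommGroup V] [Module F V]
    [FiniteDimensional F V] (hV : finrank F V = 4) :
    Nat.card {U : Submodule F V // finrank F U = 2} =
      (Fintype.card F ^ 2 + 1) * (Fintype.card F ^ 2 + Fintype.card F + 1) := by
  have : Finite V := Module.finite_of_finite F
  let e : {s : Fin 2 → V // LinearIndependent F s} ≃
      Σ U : {U : Submodule F V // finrank F U = 2}, {s : Fin 2 → U.1 // LinearIndependent F s} :=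
    { toFun := fun s => ⟨⟨Submodule.span F (Set.range s.1), by
          simpa using finrank_span_eq_card s.2⟩,
          ⟨fun i => ⟨s.1 i, Submodule.subset_span ⟨i, rfl⟩⟩, linearIndependent_span s.2⟩⟩
      invFun := fun t => ⟨fun i => t.2.1 i,
        t.2.2.map' t.1.1.subtype (Submodule.ker_subtype _)⟩
      left_inv := fun s => rfl
      right_inv := by
        have key : ∀ (U : Submodule F V) (hU : finrank F U = 2) (s : Fin 2 → V)
            (h : ∀ i, s i ∈ U), LinearIndependent F s → Submodule.span F (Set.range s) = U := by
          intro U hU s h hs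
          refine Submodule.eq_of_le_of_finrank_eq
            (Submodule.span_le.2 (by rintro _ ⟨i, rfl⟩; exact h i)) ?_
          rw [hU]
          simpa using finrank_span_eq_card hs
        rintro ⟨⟨U, hU⟩, ⟨s, hs⟩⟩
        obtain ⟨s', h', rfl⟩ : ∃ (s' : Fin 2 → V) (h : ∀ i, s' i ∈ U), s = fun i => ⟨s' i, h i⟩ :=
          ⟨fun i => s i, fun i => (s i).2, rfl⟩
        obtain rfl := key U hU s' h' (hs.map' U.subtype (Submodule.ker_subtype _))
        rfl }
  have : Fintype {U : Submodule F V // finrank F U = 2} := Fintype.ofFinite _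
  have h1 := Nat.card_congr e
  rw [card_linearIndependent (by omega), Nat.card_sigma] at h1
  have h2 : ∀ U : {U : Submodule F V // finrank F U = 2},
      Nat.card {s : Fin 2 → U.1 // LinearIndependent F s} =
        (Fintype.card F ^ 2 - 1) * (Fintype.card F ^ 2 - Fintype.card F) := fun U => by
    rw [card_linearIndependent U.2.ge, U.2]
    simp [Fin.prod_univ_two]
  simp_rw [h2, hV] at h1
  rw [Finset.sum_const, Finset.card_univ, smul_eq_mul, Fin.prod_univ_two] at h1
  simp only [Fin.val_zero, pow_zero, Fin.val_one, pow_one] at h1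
  obtain ⟨m, hm⟩ : ∃ m, Fintype.card F = m + 2 :=
    Nat.exists_eq_add_of_le' (Fintype.one_lt_card (α := F))
  rw [Nat.card_eq_fintype_card]
  rw [hm] at h1 ⊢
  have e1 : (m + 2) ^ 4 - 1 = ((m + 2) ^ 2 - 1) * ((m + 2) ^ 2 + 1) := by
    rw [mul_comm, ← Nat.sq_sub_sq]; ring_nf
  have e2 : (m + 2) ^ 4 - (m + 2) =
      ((m + 2) ^ 2 - (m + 2)) * ((m + 2) ^ 2 + (m + 2) + 1) := by
    have : (m + 2) ^ 2 - (m + 2) = (m + 2) * (m + 1) := by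
      apply Nat.sub_eq_of_eq_add; ring
    rw [this]
    apply Nat.sub_eq_of_eq_add; ring
  have h3 : 0 < (m + 2) ^ 2 - 1 := Nat.sub_pos_of_lt (by nlinarith)
  have h4 : 0 < (m + 2) ^ 2 - (m + 2) := Nat.sub_pos_of_lt (by nlinarith)
  rw [e1, e2] at h1
  refine (Nat.eq_of_mul_eq_mul_right (Nat.mul_pos h3 h4) ?_).symm
  rw [← h1]; ring

/-- Data on a quadratic extension `E` of `F` from which a parallelism of `E × E` is built. -/
structure TwistData (F E : Type*) [Field F] [Field E] [Algebra F E] where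
  θ : E
  M : E →ₗ[F] E
  h : E → E
  not_mem (u v : F) : u • (1 : E) + v • θ = 0 → u = 0 ∧ v = 0
  ne_mul : M θ ≠ M 1 * θ
  no_eigenvalue (a a' : F) : a ≠ 0 → a' ≠ 0 → a ≠ a' → ∀ x : E, x ≠ 0 → ∀ b : F, M x ≠ b • x
  avoid (a b : F) : a ≠ 0 → ∀ w : E, w ≠ 0 → a • M w ≠ b • w + h w * w

theorem exists_no_root (F : Type*) [Field F] [Finite F] : ∃ s : F, ∀ x : F, x ^ 2 - x + s ≠ 0 := by
  have h : ¬ Function.Injective fun x : F => x - x ^ 2 := fun h => by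
    have := @h 0 1 (by simp)
    simp at this
  have h2 := mt Finite.injective_iff_surjective.2 h
  simp only [Function.Surjective, not_forall, not_exists] at h2
  obtain ⟨s, hs⟩ := h2
  exact ⟨s, fun x hx => hs x (by linear_combination -hx)⟩

theorem exists_twistData (F : Type) [Field F] [Finite F] :
    ∃ (E : Type) (_ : Field E) (_ : Algebra F E), finrank F E = 2 ∧ Nonempty (TwistData F E) := by
  obtain ⟨s, hs⟩ := exists_no_root F
  have : Fact (∀ r : F, r ^ 2 ≠ -s + 1 * r) := ⟨fun r hr => hs r (by linear_combination hr)⟩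
  refine ⟨QuadraticAlgebra F (-s) 1, inferInstance, inferInstance,
    QuadraticAlgebra.finrank_eq_two _ _, ?_⟩
  let lin (p q r t : F) : QuadraticAlgebra F (-s) 1 →ₗ[F] QuadraticAlgebra F (-s) 1 :=
    { toFun := fun x => ⟨p * x.re + q * x.im, r * x.re + t * x.im⟩
      map_add' := fun x y => by ext <;> simp <;> ring
      map_smul' := fun c x => by ext <;> simp <;> ring }
  have hθ : ∀ u v : F, u • (1 : QuadraticAlgebra F (-s) 1) + v • ⟨0, 1⟩ = 0 → u = 0 ∧ v = 0 := by
    intro u v h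
    simpa [QuadraticAlgebra.ext_iff, QuadraticAlgebra.re_one, QuadraticAlgebra.im_one] using h
  by_cases h2 : ∃ c : F, c ≠ 0 ∧ c ≠ 1
  · obtain ⟨c, hc0, hc1⟩ := h2
    have heig : ∀ x : QuadraticAlgebra F (-s) 1, x ≠ 0 → ∀ b : F,
        lin 0 (-s / c) c 1 x ≠ b • x := by
      intro x hx b h
      simp only [lin, LinearMap.coe_mk, AddHom.coe_mk, QuadraticAlgebra.ext_iff,
        QuadraticAlgebra.re_smul, QuadraticAlgebra.im_smul, smul_eq_mul] at h
      obtain ⟨h3, h4⟩ := h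
      rw [zero_mul, zero_add, div_mul_eq_mul_div, div_eq_iff hc0] at h3
      have h5 : x.im = 0 := by
        have : x.im * (b ^ 2 - b + s) = 0 := by linear_combination -h3 - b * h4
        exact (mul_eq_zero.1 this).resolve_right (hs b)
      rw [h5, mul_zero, mul_zero, add_zero] at h4
      exact hx (QuadraticAlgebra.ext ((mul_eq_zero.1 h4).resolve_left hc0) h5)
    refine ⟨⟨⟨0, 1⟩, lin 0 (-s / c) c 1, 0, hθ, ?_, ?_, ?_⟩⟩
    · simp only [lin, LinearMap.coe_mk, AddHom.coe_mk, ne_eq, QuadraticAlgebra.ext_iff, not_and,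
        QuadraticAlgebra.re_mul, QuadraticAlgebra.im_mul, QuadraticAlgebra.re_one,
        QuadraticAlgebra.im_one]
      intro _ h
      exact hc1 (by linear_combination -h)
    · intro a a' _ _ _ x hx b
      exact heig x hx b
    · intro a b ha w hw h
      refine heig w hw (a⁻¹ * b) ?_
      rw [Pi.zero_apply, zero_mul, add_zero] at h
      rw [mul_smul, ← h, inv_smul_smul₀ ha]
  · push Not at h2
    refine ⟨⟨⟨0, 1⟩, lin 1 0 0 0, fun w => lin 1 0 0 0 w / w + ⟨0, 1⟩, hθ, ?_, ?_, ?_⟩⟩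
    · simp [lin, QuadraticAlgebra.ext_iff, QuadraticAlgebra.re_one]
    · intro a a' ha ha' h
      exact absurd ((h2 a ha).trans (h2 a' ha').symm) h
    · intro a b ha w hw h
      rw [h2 a ha, one_smul, add_mul, div_mul_cancel₀ _ hw, add_left_comm, left_eq_add] at h
      have h3 : (b • (1 : QuadraticAlgebra F (-s) 1) + (1 : F) • ⟨0, 1⟩) * w = 0 := by
        rw [add_mul, smul_mul_assoc, one_mul, one_smul, h]
      exact one_ne_zero (hθ b 1 ((mul_eq_zero.1 h3).resolve_right hw)).2

namespace TwistData

variable {F E : Type} [Field F] [Field E] [Algebra F E] (D : TwistData F E)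

/-- Representatives of the points of the projective line over `F` attached to `E`. -/
def rep : Option F → E
  | none => 1
  | some t => t • 1 + D.θ

theorem rep_ne_zero (i : Option F) : D.rep i ≠ 0 := by
  cases i with
  | none => exact one_ne_zero
  | some t => exact fun h => one_ne_zero (D.not_mem t 1 (by simpa [rep] using h)).2

theorem eq_and_eq_of_add_eq {u v u' v' : F}
    (h : u • (1 : E) + v • D.θ = u' • (1 : E) + v' • D.θ) : u = u' ∧ v = v' := by
  have h' := D.not_mem (u - u') (v - v') (by rw [sub_smul, sub_smul]; linear_combination h)
  exact ⟨sub_eq_zero.1 h'.1, sub_eq_zero.1 h'.2⟩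

theorem smul_rep_eq {b b' : F} {i i' : Option F} (h : b • D.rep i = b' • D.rep i') :
    b = b' ∧ (b ≠ 0 → i = i') := by
  cases i with
  | none =>
    cases i' with
    | none =>
      have := D.eq_and_eq_of_add_eq (u := b) (v := 0) (u' := b') (v' := 0) (by simpa [rep] using h)
      simp [this.1]
    | some t =>
      have := D.eq_and_eq_of_add_eq (u := b) (v := 0) (u' := b' * t) (v' := b')
        (by simpa [rep, mul_smul] using h)
      have h0 : b = 0 := by rw [this.1, ← this.2, zero_mul]
      exact ⟨h0.trans this.2, fun h1 => absurd h0 h1⟩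
  | some t =>
    cases i' with
    | none =>
      have := D.eq_and_eq_of_add_eq (u := b * t) (v := b) (u' := b') (v' := 0)
        (by simpa [rep, mul_smul] using h)
      have h0 : b' = 0 := by rw [← this.1, this.2, zero_mul]
      exact ⟨this.2.trans h0.symm, fun h1 => absurd this.2 h1⟩
    | some t' =>
      have := D.eq_and_eq_of_add_eq (u := b * t) (v := b) (u' := b' * t') (v' := b')
        (by simpa [rep, mul_smul] using h)
      refine ⟨this.2, fun h1 => ?_⟩
      have h2 := this.1
      rw [← this.2] at h2
      rw [mul_left_cancel₀ h1 h2]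

/-- The regular spread of `E × E`, whose members are the `E`-lines. -/
def regularSpread : Option E → Submodule F (E × E)
  | none => LinearMap.range (LinearMap.inr F E E)
  | some m => (LinearMap.mulLeft F m).graph

/-- The linear map whose graph is a member of the twisted spread. -/
def twistMap (a : E) (c : F) (p : F × F) : E →ₗ[F] E :=
  (LinearMap.mulLeft F a).comp (LinearMap.mulLeft F (c • D.θ + p.2 • 1) + p.1 • D.M)

theorem twistMap_apply (a : E) (c : F) (p : F × F) (x : E) :
    D.twistMap a c p x = a * ((c • D.θ + p.2 • 1) * x + p.1 • D.M x) := rfl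

/-- A plane of `E × E` meeting the vertical axis in the multiples of `a * w`. -/
def tiltPlane (a : E) (c : F) (w : E) : Submodule F (E × E) :=
  LinearMap.range <| LinearMap.prod ((LinearMap.fst F F F).smulRight w)
    ((LinearMap.snd F F F).smulRight (a * w) +
      (LinearMap.fst F F F).smulRight (a * ((c • D.θ + D.h w) * w)))

theorem mem_tiltPlane {a : E} {c : F} {w : E} {z : E × E} : z ∈ D.tiltPlane a c w ↔
    ∃ d b : F, z = (d • w, b • (a * w) + d • (a * ((c • D.θ + D.h w) * w))) := by
  constructor
  · rintro ⟨⟨d, b⟩, rfl⟩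
    exact ⟨d, b, rfl⟩
  · rintro ⟨d, b, rfl⟩
    exact ⟨⟨d, b⟩, rfl⟩

/-- The spreads other than the regular one. -/
def twistedSpread (k : Option F × F) : (Fˣ × F) ⊕ Option F → Submodule F (E × E)
  | .inl p => (D.twistMap (D.rep k.1) k.2 (p.1, p.2)).graph
  | .inr w => D.tiltPlane (D.rep k.1) k.2 (D.rep w)

theorem mem_regularSpread_none {z : E × E} :
    z ∈ regularSpread (F := F) (none : Option E) ↔ z.1 = 0 := by
  constructor
  · rintro ⟨y, rfl⟩
    rfl
  · intro h
    exact ⟨z.2, Prod.ext h.symm rfl⟩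

theorem mem_regularSpread_some {m : E} {z : E × E} :
    z ∈ regularSpread (F := F) (some m) ↔ z.2 = m * z.1 :=
  LinearMap.mem_graph_iff _ _

theorem eq_and_eq_of_forall_mul_add_mul {e n e' n' : E}
    (h : ∀ x, e * x + n * D.M x = e' * x + n' * D.M x) : e = e' ∧ n = n' := by
  have h1 := h 1
  have h2 := h D.θ
  have h3 : (n - n') * (D.M D.θ - D.M 1 * D.θ) = 0 := by linear_combination h2 - D.θ * h1
  obtain rfl := sub_eq_zero.1 ((mul_eq_zero.1 h3).resolve_right (sub_ne_zero.2 D.ne_mul))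
  exact ⟨by linear_combination h1, rfl⟩

theorem finrank_regularSpread (hE : finrank F E = 2) (m : Option E) :
    finrank F (regularSpread (F := F) m) = 2 := by
  cases m with
  | none =>
    rw [regularSpread, LinearMap.finrank_range_of_inj LinearMap.inr_injective, hE]
  | some m => exact (finrank_graph _).trans hE

theorem finrank_twistedSpread (hE : finrank F E = 2) (k : Option F × F) (j : (Fˣ × F) ⊕ Option F) :
    finrank F (D.twistedSpread k j) = 2 := by
  cases j with
  | inl p => exact (finrank_graph _).trans hE
  | inr w =>
    rw [twistedSpread, tiltPlane, LinearMap.finrank_range_of_inj]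
    · simp
    · rw [← LinearMap.ker_eq_bot, LinearMap.ker_eq_bot']
      rintro ⟨d, b⟩ h
      have h1 : d • D.rep w = 0 := congrArg Prod.fst h
      obtain rfl := (smul_eq_zero.1 h1).resolve_right (D.rep_ne_zero w)
      have h2 : b • (D.rep k.1 * D.rep w) +
        (0 : F) • (D.rep k.1 * ((k.2 • D.θ + D.h (D.rep w)) * D.rep w)) = 0 := congrArg Prod.snd h
      rw [zero_smul, add_zero] at h2
      rw [(smul_eq_zero.1 h2).resolve_right (mul_ne_zero (D.rep_ne_zero _) (D.rep_ne_zero w))]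
      rfl

theorem regularSpread_inf {m m' : Option E} (h : m ≠ m') :
    regularSpread (F := F) m ⊓ regularSpread m' = ⊥ := by
  rw [Submodule.eq_bot_iff]
  rintro ⟨x, y⟩ ⟨h1, h2⟩
  cases m <;> cases m' <;>
    simp only [SetLike.mem_coe, mem_regularSpread_none, mem_regularSpread_some] at h1 h2
  · exact absurd rfl h
  · simp [h1, h2]
  · simp [h1, h2]
  · rename_i m m'
    have h3 : (m - m') * x = 0 := by linear_combination h2 - h1
    have h4 : x = 0 := (mul_eq_zero.1 h3).resolve_left (sub_ne_zero.2 fun h' => h (h' ▸ rfl))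
    simp [h1, h4]

theorem graph_inf_graph {a : E} (c : F) (ha : a ≠ 0) {p p' : Fˣ × F} (h : p ≠ p') :
    (D.twistMap a c (p.1, p.2)).graph ⊓ (D.twistMap a c (p'.1, p'.2)).graph = ⊥ := by
  rw [Submodule.eq_bot_iff]
  rintro ⟨x, y⟩ ⟨h1, h2⟩
  simp only [SetLike.mem_coe, LinearMap.mem_graph_iff] at h1 h2
  by_cases hx : x = 0
  · rw [h1, hx, map_zero]; rfl
  exfalso
  rw [h2, twistMap_apply, twistMap_apply] at h1
  replace h1 := mul_left_cancel₀ ha h1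
  have h3 : ((p.1 : F) - p'.1) • D.M x = (p'.2 - p.2) • x := by
    rw [add_mul, add_mul, smul_one_mul, smul_one_mul] at h1
    rw [sub_smul, sub_smul]
    linear_combination -h1
  by_cases h4 : (p.1 : F) = p'.1
  · rw [h4, sub_self, zero_smul, eq_comm] at h3
    have h5 := sub_eq_zero.1 ((smul_eq_zero.1 h3).resolve_right hx)
    exact h (Prod.ext (Units.ext h4) h5.symm)
  · refine D.no_eigenvalue _ _ p.1.ne_zero p'.1.ne_zero h4 x hx
      (((p.1 : F) - p'.1)⁻¹ * (p'.2 - p.2)) ?_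
    rw [mul_smul, ← h3, inv_smul_smul₀ (sub_ne_zero.2 h4)]

theorem graph_inf_tiltPlane {a : E} (c : F) (ha : a ≠ 0) {w : E} (hw : w ≠ 0) (p : Fˣ × F) :
    (D.twistMap a c (p.1, p.2)).graph ⊓ D.tiltPlane a c w = ⊥ := by
  rw [Submodule.eq_bot_iff]
  rintro z ⟨h1, h2⟩
  simp only [SetLike.mem_coe, LinearMap.mem_graph_iff, mem_tiltPlane] at h1 h2
  obtain ⟨d, b, rfl⟩ := h2
  by_cases hd : d = 0
  · subst hd
    simp only [zero_smul, map_zero] at h1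
    simp only [zero_smul, h1]
    rfl
  exfalso
  rw [twistMap_apply, ← mul_smul_comm, ← mul_smul_comm, ← mul_add] at h1
  replace h1 := mul_left_cancel₀ ha h1
  refine D.avoid p.1 (d⁻¹ * b - p.2) p.1.ne_zero w hw ?_
  have h3 : b • w + d • (D.h w * w) = d • (p.2 • w + (p.1 : F) • D.M w) := by
    rw [map_smul] at h1
    simp only [Algebra.smul_def, mul_one] at h1 ⊢
    linear_combination h1
  have h4 := congrArg (d⁻¹ • ·) h3
  simp only [smul_add, inv_smul_smul₀ hd] at h4
  rw [sub_smul, mul_smul]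
  linear_combination -h4

theorem tiltPlane_inf_tiltPlane {a : E} (c : F) (ha : a ≠ 0) {i i' : Option F} (h : i ≠ i') :
    D.tiltPlane a c (D.rep i) ⊓ D.tiltPlane a c (D.rep i') = ⊥ := by
  rw [Submodule.eq_bot_iff]
  rintro z ⟨h1, h2⟩
  simp only [SetLike.mem_coe, mem_tiltPlane] at h1 h2
  obtain ⟨d, b, rfl⟩ := h1
  obtain ⟨d', b', h2⟩ := h2
  have h3 := D.smul_rep_eq (congrArg Prod.fst h2)
  have h4 : d = 0 := by
    by_contra h4
    exact h (h3.2 h4)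
  obtain rfl : d' = 0 := h3.1.symm.trans h4
  subst h4
  have h5 := congrArg Prod.snd h2
  simp only [zero_smul, add_zero] at h5
  rw [← mul_smul_comm, ← mul_smul_comm] at h5
  have h6 := D.smul_rep_eq (mul_left_cancel₀ ha h5)
  have h7 : b = 0 := by
    by_contra h7
    exact h (h6.2 h7)
  simp [h7]

theorem twistedSpread_inf (k : Option F × F) {j j' : (Fˣ × F) ⊕ Option F} (h : j ≠ j') :
    D.twistedSpread k j ⊓ D.twistedSpread k j' = ⊥ := by
  have ha := D.rep_ne_zero k.1
  rcases j with p | w <;> rcases j' with p' | w'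
  · exact D.graph_inf_graph k.2 ha fun h' => h (h' ▸ rfl)
  · exact D.graph_inf_tiltPlane k.2 ha (D.rep_ne_zero w') p
  · rw [inf_comm]
    exact D.graph_inf_tiltPlane k.2 ha (D.rep_ne_zero w) p'
  · exact D.tiltPlane_inf_tiltPlane k.2 ha fun h' => h (h' ▸ rfl)

theorem vertical_mem_tiltPlane (a : E) (c : F) (w : E) : ((0 : E), a * w) ∈ D.tiltPlane a c w :=
  D.mem_tiltPlane.2 ⟨0, 1, by simp⟩

theorem graph_ne_tiltPlane (f : E →ₗ[F] E) {a : E} (c : F) {w : E} (ha : a ≠ 0) (hw : w ≠ 0) :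
    f.graph ≠ D.tiltPlane a c w := fun h => by
  have h1 := D.vertical_mem_tiltPlane a c w
  rw [← h, LinearMap.mem_graph_iff, map_zero] at h1
  exact mul_ne_zero ha hw h1

theorem regularSpread_ne_twistedSpread (m : Option E) (k : Option F × F)
    (j : (Fˣ × F) ⊕ Option F) : regularSpread m ≠ D.twistedSpread k j := by
  have ha := D.rep_ne_zero k.1
  intro h
  cases m with
  | none =>
    have h1 (z) (hz : z ∈ D.twistedSpread k j) : z.1 = 0 := by
      rwa [← h, mem_regularSpread_none] at hz
    rcases j with p | w
    · exact one_ne_zero (h1 (1, D.twistMap _ _ _ 1) ((LinearMap.mem_graph_iff _ _).2 rfl))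
    · exact D.rep_ne_zero w (by simpa using h1 _ (D.mem_tiltPlane.2 ⟨1, 0, rfl⟩))
  | some m =>
    rcases j with p | w
    · have h1 (x : E) : (x, m * x) ∈ D.twistedSpread k (.inl p) := by
        rw [← h, mem_regularSpread_some]
      have h2 := D.eq_and_eq_of_forall_mul_add_mul (e := m) (n := 0)
        (e' := D.rep k.1 * (k.2 • D.θ + p.2 • 1)) (n' := (p.1 : F) • D.rep k.1) fun x => by
          have h3 := (LinearMap.mem_graph_iff _ _).1 (h1 x)
          rw [twistMap_apply] at h3
          rw [zero_mul, add_zero, smul_mul_assoc, ← mul_smul_comm]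
          linear_combination h3
      exact smul_ne_zero p.1.ne_zero ha h2.2.symm
    · exact D.graph_ne_tiltPlane _ _ ha (D.rep_ne_zero w) h

theorem eq_of_graph_eq {k k' : Option F × F} {p p' : Fˣ × F}
    (h : D.twistedSpread k (.inl p) = D.twistedSpread k' (.inl p')) : k = k' := by
  have h1 (x : E) := (LinearMap.mem_graph_iff _ (x, _)).1
    (h.le ((LinearMap.mem_graph_iff _ _).2 rfl))
  have h2 := D.eq_and_eq_of_forall_mul_add_mul
    (e := D.rep k.1 * (k.2 • D.θ + p.2 • 1)) (n := (p.1 : F) • D.rep k.1)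
    (e' := D.rep k'.1 * (k'.2 • D.θ + p'.2 • 1)) (n' := (p'.1 : F) • D.rep k'.1) fun x => by
      have h3 := h1 x
      simp only [twistMap_apply] at h3
      rw [smul_mul_assoc, smul_mul_assoc, ← mul_smul_comm, ← mul_smul_comm]
      linear_combination h3
  have h4 := (D.smul_rep_eq h2.2).2 p.1.ne_zero
  have h5 := h2.1
  rw [h4] at h5
  replace h5 := mul_left_cancel₀ (D.rep_ne_zero _) h5
  rw [add_comm, add_comm (k'.2 • D.θ)] at h5
  exact Prod.ext h4 (D.eq_and_eq_of_add_eq h5).2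

theorem eq_of_tiltPlane_eq {k k' : Option F × F} {w w' : Option F}
    (h : D.twistedSpread k (.inr w) = D.twistedSpread k' (.inr w')) : k = k' := by
  obtain ⟨d, b, h1⟩ := D.mem_tiltPlane.1 (h.le (D.mem_tiltPlane.2 ⟨1, 0, rfl⟩))
  obtain ⟨h2, h3⟩ := D.smul_rep_eq (congrArg Prod.fst h1)
  obtain rfl := h3 one_ne_zero
  subst h2
  obtain ⟨d, b', h4⟩ := D.mem_tiltPlane.1 (h.le (D.vertical_mem_tiltPlane _ _ _))
  have h5 : d = 0 := (smul_eq_zero.1 (congrArg Prod.fst h4).symm).resolve_right (D.rep_ne_zero _)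
  subst h5
  have h6 := congrArg Prod.snd h4
  simp only [zero_smul, add_zero] at h6
  rw [← smul_mul_assoc] at h6
  replace h6 := mul_right_cancel₀ (D.rep_ne_zero _) h6
  have h7 := (D.smul_rep_eq ((one_smul F _).trans h6)).2 one_ne_zero
  have h8 := congrArg Prod.snd h1
  simp only [h7, one_smul, zero_smul, zero_add, ← mul_smul_comm, ← mul_add] at h8
  replace h8 := mul_left_cancel₀ (D.rep_ne_zero _) h8
  rw [← smul_one_mul b, ← add_mul] at h8
  replace h8 := mul_right_cancel₀ (D.rep_ne_zero _) h8
  have h9 : (0 : F) • (1 : E) + k.2 • D.θ = b • 1 + k'.2 • D.θ := by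
    rw [zero_smul, zero_add]
    linear_combination h8
  exact Prod.ext h7 (D.eq_and_eq_of_add_eq h9).2

theorem eq_of_twistedSpread_eq {k k' : Option F × F} {j j' : (Fˣ × F) ⊕ Option F}
    (h : D.twistedSpread k j = D.twistedSpread k' j') : k = k' := by
  rcases j with p | w <;> rcases j' with p' | w'
  · exact D.eq_of_graph_eq h
  · exact absurd h (D.graph_ne_tiltPlane _ _ (D.rep_ne_zero _) (D.rep_ne_zero _))
  · exact absurd h.symm (D.graph_ne_tiltPlane _ _ (D.rep_ne_zero _) (D.rep_ne_zero _))
  · exact D.eq_of_tiltPlane_eq h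

end TwistData

/-- A parallelism of a four-dimensional space: planes in `q² + q + 1` spreads of size `q² + 1`. -/
theorem exists_parallelism (F : Type) [Field F] [Fintype F] :
    ∃ P : Fin (Fintype.card F ^ 2 + Fintype.card F + 1) → Fin (Fintype.card F ^ 2 + 1) →
        Submodule F (Fin 4 → F),
      (∀ k j, finrank F (P k j) = 2) ∧ (∀ k j j', j ≠ j' → P k j ⊓ P k j' = ⊥) ∧
      ∀ k k' j j', P k j = P k' j' → k = k' := by
  classical
  obtain ⟨E, _, _, hE, ⟨D⟩⟩ := exists_twistData F
  have : FiniteDimensional F E := FiniteDimensional.of_finrank_eq_succ hE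
  have : Finite E := Module.finite_of_finite F
  have : Fintype E := Fintype.ofFinite E
  have hcE : Fintype.card E = Fintype.card F ^ 2 := by
    rw [Module.card_eq_pow_finrank (K := F), hE]
  obtain ⟨e⟩ : Nonempty ((E × E) ≃ₗ[F] (Fin 4 → F)) :=
    ⟨LinearEquiv.ofFinrankEq _ _ (by simp [hE])⟩
  have hq : 1 ≤ Fintype.card F := Fintype.card_pos
  let ι : Option (Option F × F) ≃ Fin (Fintype.card F ^ 2 + Fintype.card F + 1) :=
    Fintype.equivFinOfCardEq (by simp; ring)
  let κ : Option E ≃ Fin (Fintype.card F ^ 2 + 1) := Fintype.equivFinOfCardEq (by simp [hcE])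
  let μ : (Fˣ × F) ⊕ Option F ≃ Fin (Fintype.card F ^ 2 + 1) :=
    Fintype.equivFinOfCardEq (by
      simp only [Fintype.card_sum, Fintype.card_prod, Fintype.card_option,
        Fintype.card_units]
      obtain ⟨m, hm⟩ := Nat.exists_eq_add_of_le' hq
      rw [hm, Nat.add_sub_cancel]
      ring)
  let Q : Option (Option F × F) → Fin (Fintype.card F ^ 2 + 1) → Submodule F (E × E) := fun k j =>
    k.elim (TwistData.regularSpread (κ.symm j)) fun k => D.twistedSpread k (μ.symm j)
  have hQ1 (k j) : finrank F (Q k j) = 2 := by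
    cases k with
    | none => exact TwistData.finrank_regularSpread hE _
    | some k => exact D.finrank_twistedSpread hE _ _
  have hQ2 (k j j') (h : j ≠ j') : Q k j ⊓ Q k j' = ⊥ := by
    cases k with
    | none => exact TwistData.regularSpread_inf (κ.symm.injective.ne h)
    | some k => exact D.twistedSpread_inf _ (μ.symm.injective.ne h)
  have hQ3 (k k' j j') (h : Q k j = Q k' j') : k = k' := by
    cases k with
    | none =>
      cases k' with
      | none => rfl
      | some k' => exact absurd h (D.regularSpread_ne_twistedSpread _ _ _)
    | some k =>
      cases k' with
      | none => exact absurd h.symm (D.regularSpread_ne_twistedSpread _ _ _)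
      | some k' => exact congrArg some (D.eq_of_twistedSpread_eq h)
  refine ⟨fun k j => (Q (ι.symm k) j).map (e : (E × E) →ₗ[F] (Fin 4 → F)), fun k j => ?_,
    fun k j j' h => ?_, fun k k' j j' h => ?_⟩
  · rw [LinearEquiv.finrank_map_eq, hQ1]
  · rw [← Submodule.map_inf _ e.injective, hQ2 _ _ _ h, Submodule.map_bot]
  · exact ι.symm.injective (hQ3 _ _ _ _ (Submodule.map_injective_of_injective e.injective h))

theorem finrank_inf_le_one {F V : Type*} [Field F] [AddCommGroup V] [Module F V]
    [FiniteDimensional F V] {U U' : Submodule F V} (hU : finrank F U = 2) (hU' : finrank F U' = 2)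
    (h : U ≠ U') : finrank F (U ⊓ U' : Submodule F V) ≤ 1 := by
  by_contra h1
  have h2 : U ⊓ U' = U := Submodule.eq_of_le_of_finrank_le inf_le_left (by omega)
  have h3 : U ⊓ U' = U' := Submodule.eq_of_le_of_finrank_le inf_le_right (by omega)
  exact h (h2.symm.trans h3)

/-- The matrices annihilated by the multiplication of a degree four extension `L` of `F`. -/
theorem isMRD_of_finrank (F : Type) [Field F] {L : Type*} [Field L] [Algebra F L]
    (hL : finrank F L = 4) :
    ∃ C : Submodule F (Matrix (Fin 4) (Fin (8 - 4)) F), IsMRD F 8 4 2 C := by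
  have : FiniteDimensional F L := FiniteDimensional.of_finrank_eq_succ hL
  let b : Basis (Fin 4) F L := finBasisOfFinrankEq F L hL
  let b' : Basis (Fin (8 - 4)) F L := finBasisOfFinrankEq F L hL
  let Φ : Matrix (Fin 4) (Fin (8 - 4)) F →ₗ[F] L :=
    { toFun := fun A => ∑ i, ∑ j, A i j • (b i * b' j)
      map_add' := fun A B => by simp [add_smul, Finset.sum_add_distrib]
      map_smul' := fun c A => by simp [mul_smul, Finset.smul_sum] }
  have hvec (v : Fin 4 → F) (c : Fin (8 - 4) → F) :
      Φ (vecMulVec v c) = (∑ i, v i • b i) * ∑ j, c j • b' j := by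
    simp only [Φ, LinearMap.coe_mk, AddHom.coe_mk, vecMulVec_apply, Finset.sum_mul_sum,
      smul_mul_smul_comm]
  refine ⟨LinearMap.ker Φ, ?_, fun A hA hA0 => ?_⟩
  · have hsurj : LinearMap.range Φ = ⊤ := by
      refine LinearMap.range_eq_top.2 fun l => ?_
      refine ⟨vecMulVec (Pi.single 0 1) (b'.repr ((b 0)⁻¹ * l)), ?_⟩
      rw [hvec, b'.sum_repr]
      simp [Pi.single_apply, b.ne_zero]
    have := LinearMap.finrank_range_add_finrank_ker Φ
    rw [hsurj, finrank_top, hL, finrank_matrix] at this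
    simp at this ⊢
    omega
  · by_contra h
    have h1 : finrank F (LinearMap.range A.mulVecLin) ≤ 1 := by
      rw [Matrix.rank] at h
      omega
    obtain ⟨v, hv⟩ := finrank_le_one_iff.1 h1
    choose c hc using fun j => hv ⟨A.col j, Pi.single j 1, by simp⟩
    have hAv : A = vecMulVec v.1 c := by
      ext i j
      have := congrFun (congrArg Subtype.val (hc j)) i
      rw [vecMulVec_apply, mul_comm]
      exact this.symm
    rw [hAv, LinearMap.mem_ker, hvec, mul_eq_zero] at hA
    refine hA0 (hAv.trans ?_)
    rcases hA with h2 | h2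
    · rw [funext (Fintype.linearIndependent_iff.1 b.linearIndependent _ h2)]
      exact zero_vecMulVec _
    · rw [funext (Fintype.linearIndependent_iff.1 b'.linearIndependent _ h2)]
      exact vecMulVec_zero _

/-- A maximum rank distance code of `4 × 4` matrices with minimum rank distance two. -/
theorem exists_isMRD (F : Type) [Field F] [Finite F] :
    ∃ C : Submodule F (Matrix (Fin 4) (Fin (8 - 4)) F), IsMRD F 8 4 2 C := by
  obtain ⟨p, hp⟩ := CharP.exists F
  have : Fact p.Prime := ⟨CharP.char_is_prime F p⟩
  exact isMRD_of_finrank F (FiniteField.finrank_extension F p 4)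

section BlockCode

variable {K V W : Type*} [Field K] [AddCommGroup V] [Module K V] [AddCommGroup W] [Module K W]

/-- The vectors `(u, w)` with `u ∈ U` and `w ∈ f u + T`. -/
def cosetSubspace (U : Submodule K V) (T : Submodule K W) (f : U →ₗ[K] W) :
    Submodule K (V × W) :=
  LinearMap.range <| (U.subtype.comp (LinearMap.fst K U T)).prod
    (f.comp (LinearMap.fst K U T) + T.subtype.comp (LinearMap.snd K U T))

theorem mem_cosetSubspace {U : Submodule K V} {T : Submodule K W} {f : U →ₗ[K] W} {z : V × W} :
    z ∈ cosetSubspace U T f ↔ ∃ h : z.1 ∈ U, z.2 - f ⟨z.1, h⟩ ∈ T := by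
  constructor
  · rintro ⟨⟨u, t⟩, rfl⟩
    refine ⟨u.2, ?_⟩
    simp
  · rintro ⟨h, ht⟩
    exact ⟨(⟨z.1, h⟩, ⟨_, ht⟩), by ext <;> simp⟩

theorem fst_mem_of_mem_cosetSubspace {U : Submodule K V} {T : Submodule K W} {f : U →ₗ[K] W}
    {z : V × W} (h : z ∈ cosetSubspace U T f) : z.1 ∈ U :=
  (mem_cosetSubspace.1 h).1

theorem snd_mem_of_mem_cosetSubspace {U : Submodule K V} {T : Submodule K W} {f : U →ₗ[K] W}
    {w : W} (h : ((0 : V), w) ∈ cosetSubspace U T f) : w ∈ T := by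
  obtain ⟨h0, h⟩ := mem_cosetSubspace.1 h
  have : (⟨0, h0⟩ : U) = 0 := rfl
  simpa [this] using h

theorem graph_inf_range_inr (g : V →ₗ[K] W) :
    g.graph ⊓ LinearMap.range (LinearMap.inr K V W) = ⊥ := by
  rw [Submodule.eq_bot_iff]
  rintro _ ⟨h, y, rfl⟩
  have h1 := (LinearMap.mem_graph_iff _ _).1 h
  rw [LinearMap.inr_apply, map_zero] at h1
  rw [LinearMap.inr_apply]
  exact congrArg _ h1

variable [FiniteDimensional K V] [FiniteDimensional K W]

theorem finrank_cosetSubspace (U : Submodule K V) (T : Submodule K W) (f : U →ₗ[K] W) :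
    finrank K (cosetSubspace U T f) = finrank K U + finrank K T := by
  rw [cosetSubspace, LinearMap.finrank_range_of_inj, finrank_prod]
  rintro ⟨u, t⟩ ⟨u', t'⟩ h
  obtain rfl : u = u' := Subtype.ext (congrArg Prod.fst h)
  have h2 : f u + (t : W) = f u + t' := congrArg Prod.snd h
  rw [Subtype.ext (add_left_cancel h2)]

theorem finrank_cosetSubspace_inf_le (U U' : Submodule K V) (T T' : Submodule K W)
    (f : U →ₗ[K] W) (f' : U' →ₗ[K] W) :
    finrank K (cosetSubspace U T f ⊓ cosetSubspace U' T' f' : Submodule K (V × W)) ≤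
      finrank K (U ⊓ U' : Submodule K V) + finrank K (T ⊓ T' : Submodule K W) :=
  finrank_le_add_of_fst_mem _ _ _
    (fun _ hz => ⟨fst_mem_of_mem_cosetSubspace hz.1, fst_mem_of_mem_cosetSubspace hz.2⟩)
    fun _ hy => ⟨snd_mem_of_mem_cosetSubspace hy.1, snd_mem_of_mem_cosetSubspace hy.2⟩

theorem finrank_cosetSubspace_inf_le_of_disjoint (U : Submodule K V) (T : Submodule K W)
    (f f' : U →ₗ[K] W) (h : ∀ u, f u - f' u ∈ T → u = 0) :
    finrank K (cosetSubspace U T f ⊓ cosetSubspace U T f' : Submodule K (V × W)) ≤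
      finrank K T := by
  have := finrank_le_add_of_fst_mem (cosetSubspace U T f ⊓ cosetSubspace U T f') ⊥ T
    (fun z hz => by
      obtain ⟨h1, h2⟩ := mem_cosetSubspace.1 hz.1
      obtain ⟨_, h3⟩ := mem_cosetSubspace.1 hz.2
      have h4 := h ⟨z.1, h1⟩ (by simpa using T.sub_mem h3 h2)
      exact congrArg Subtype.val h4)
    fun y hy => snd_mem_of_mem_cosetSubspace hy.1
  simpa using this

theorem finrank_graph_inf_graph_le (f f' : V →ₗ[K] W) :
    finrank K (f.graph ⊓ f'.graph : Submodule K (V × W)) ≤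
      finrank K (LinearMap.ker (f - f')) := by
  have := finrank_le_add_of_fst_mem (f.graph ⊓ f'.graph) (LinearMap.ker (f - f')) ⊥
    (fun z hz => by
      have h1 := (LinearMap.mem_graph_iff _ _).1 hz.1
      have h2 := (LinearMap.mem_graph_iff _ _).1 hz.2
      rw [LinearMap.mem_ker, LinearMap.sub_apply, ← h1, ← h2, sub_self])
    fun y hy => by
      have h1 := (LinearMap.mem_graph_iff _ _).1 hy.1
      rwa [map_zero] at h1
  simpa using this

theorem finrank_graph_inf_cosetSubspace_le (g : V →ₗ[K] W) (U : Submodule K V)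
    (T : Submodule K W) (f : U →ₗ[K] W) :
    finrank K (g.graph ⊓ cosetSubspace U T f : Submodule K (V × W)) ≤ finrank K U := by
  have := finrank_le_add_of_fst_mem (g.graph ⊓ cosetSubspace U T f) U ⊥
    (fun z hz => fst_mem_of_mem_cosetSubspace hz.2)
    fun y hy => by
      have h1 := (LinearMap.mem_graph_iff _ _).1 hy.1
      rwa [map_zero] at h1
  simpa using this

theorem finrank_cosetSubspace_inf_range_inr_le (U : Submodule K V) (T : Submodule K W)
    (f : U →ₗ[K] W) :
    finrank K (cosetSubspace U T f ⊓ LinearMap.range (LinearMap.inr K V W) :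
      Submodule K (V × W)) ≤ finrank K T := by
  have := finrank_le_add_of_fst_mem (cosetSubspace U T f ⊓ LinearMap.range (LinearMap.inr K V W))
    ⊥ T (fun z hz => by obtain ⟨_, y, rfl⟩ := hz; rfl)
    fun y hy => snd_mem_of_mem_cosetSubspace hy.1
  simpa using this

end BlockCode

/-- A spread set of linear maps from a plane to a quotient of dimension two. -/
theorem exists_spreadSet {K V W : Type} [Field K] [Fintype K] [AddCommGroup V] [Module K V]
    [AddCommGroup W] [Module K W] [FiniteDimensional K V] [FiniteDimensional K W]
    (hW : finrank K W = 4) (U : Submodule K V) (T : Submodule K W) (hU : finrank K U = 2)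
    (hT : finrank K T = 2) :
    ∃ f : Fin (Fintype.card K ^ 2) → U →ₗ[K] W,
      ∀ m m', m ≠ m' → ∀ u, f m u - f m' u ∈ T → u = 0 := by
  obtain ⟨E, _, _, hE, -⟩ := exists_twistData K
  have : FiniteDimensional K E := FiniteDimensional.of_finrank_eq_succ hE
  have : Finite E := Module.finite_of_finite K
  have : Fintype E := Fintype.ofFinite E
  let ε : E ≃ Fin (Fintype.card K ^ 2) :=
    Fintype.equivFinOfCardEq (by rw [Module.card_eq_pow_finrank (K := K), hE])
  obtain ⟨T', hT'⟩ := T.exists_isCompl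
  have h1 := Submodule.finrank_add_eq_of_isCompl hT'
  let i : U ≃ₗ[K] E := LinearEquiv.ofFinrankEq _ _ (hU.trans hE.symm)
  let s : E ≃ₗ[K] T' := LinearEquiv.ofFinrankEq _ _ (by omega)
  refine ⟨fun m => T'.subtype.comp (s.toLinearMap.comp
    ((LinearMap.mulLeft K (ε.symm m)).comp i.toLinearMap)), fun m m' h u hu => ?_⟩
  have h2 : (s (ε.symm m * i u) : W) - s (ε.symm m' * i u) ∈ T := hu
  have h3 := Submodule.disjoint_def.1 hT'.disjoint _ h2 (T'.sub_mem (s _).2 (s _).2)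
  have h4 := s.injective (Subtype.ext (sub_eq_zero.1 h3))
  have h5 : (ε.symm m - ε.symm m') * i u = 0 := by rw [sub_mul, h4, sub_self]
  have h6 := (mul_eq_zero.1 h5).resolve_left (sub_ne_zero.2 (ε.symm.injective.ne h))
  exact (LinearEquiv.map_eq_zero_iff i).1 h6

/-- Splitting a vector of length eight into its two halves. -/
def splitEquiv (F : Type) [Field F] : (Fin 8 → F) ≃ₗ[F] (Fin 4 → F) × (Fin (8 - 4) → F) where
  toFun v := (fun i => v (Fin.castAdd 4 i), fun j => v (Fin.natAdd 4 j))
  map_add' _ _ := rfl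
  map_smul' _ _ := rfl
  invFun p := Fin.append (m := 4) (n := 4) p.1 p.2
  left_inv v := Fin.append_castAdd_natAdd (m := 4) (n := 4) (f := v)
  right_inv p := Prod.ext (funext fun i => Fin.append_left (m := 4) (n := 4) p.1 p.2 i)
    (funext fun j => Fin.append_right (m := 4) (n := 4) p.1 p.2 j)

theorem liftSubspace_eq_map_graph (F : Type) [Field F] (A : Matrix (Fin 4) (Fin (8 - 4)) F) :
    liftSubspace F 8 4 A =
      (A.vecMulLinear.graph).map ((splitEquiv F).symm : _ →ₗ[F] (Fin 8 → F)) := by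
  have h : liftSubspace F 8 4 A = LinearMap.range (liftMatrix F 8 4 A).vecMulLinear :=
    (_root_.range_vecMulLinear _).symm
  rw [h, LinearMap.graph_eq_range_prod, ← LinearMap.range_comp]
  congr 1
  refine LinearMap.ext fun v => (splitEquiv F).injective ?_
  rw [LinearMap.comp_apply, LinearEquiv.coe_coe, LinearEquiv.apply_symm_apply]
  refine Prod.ext (funext fun i => ?_) (funext fun j => ?_)
  · simp [splitEquiv, liftMatrix, Matrix.vecMul, dotProduct, Fin.val_inj]
  · simp [splitEquiv, liftMatrix, Matrix.vecMul, dotProduct]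

/-- Two distinct codewords of an MRD code with minimum distance two agree on a space of dimension
at most two. -/
theorem IsMRD.finrank_ker_vecMulLinear_sub_le {F : Type} [Field F]
    {C : Submodule F (Matrix (Fin 4) (Fin (8 - 4)) F)} (hC : IsMRD F 8 4 2 C)
    {A B : Matrix (Fin 4) (Fin (8 - 4)) F} (hA : A ∈ C) (hB : B ∈ C) (h : A ≠ B) :
    finrank F (LinearMap.ker (A.vecMulLinear - B.vecMulLinear)) ≤ 2 := by
  have h1 := hC.2 (A - B) (C.sub_mem hA hB) (sub_ne_zero.2 h)
  have h2 : A.vecMulLinear - B.vecMulLinear = (A - B)ᵀ.mulVecLin := by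
    rw [Matrix.mulVecLin_transpose]
    ext v
    simp
  rw [← Matrix.rank_transpose] at h1
  rw [Matrix.rank, ← h2] at h1
  have h3 := LinearMap.finrank_range_add_finrank_ker (A.vecMulLinear - B.vecMulLinear)
  rw [finrank_fin_fun] at h3
  omega

theorem finrank_map_inf_map {F V V' : Type*} [Field F] [AddCommGroup V] [Module F V]
    [AddCommGroup V'] [Module F V'] (e : V ≃ₗ[F] V') (X Y : Submodule F V) :
    finrank F (X.map (e : V →ₗ[F] V') ⊓ Y.map (e : V →ₗ[F] V') : Submodule F V') =
      finrank F (X ⊓ Y : Submodule F V) := by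
  rw [← Submodule.map_inf _ e.injective, LinearEquiv.finrank_map_eq]

/-- A family of four-dimensional subspaces meeting pairwise in dimension at most two that contains
the graphs of the codewords of an MRD code. -/
theorem exists_family (F : Type) [Field F] [Fintype F]
    {C : Submodule F (Matrix (Fin 4) (Fin (8 - 4)) F)} (hC : IsMRD F 8 4 2 C) :
    ∃ X : C ⊕ (((Fin (Fintype.card F ^ 2 + Fintype.card F + 1) × Fin (Fintype.card F ^ 2 + 1) ×
        Fin (Fintype.card F ^ 2 + 1)) × Fin (Fintype.card F ^ 2)) ⊕ Unit) →
        Submodule F ((Fin 4 → F) × (Fin (8 - 4) → F)),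
      (∀ A : C, X (Sum.inl A) = A.1.vecMulLinear.graph) ∧ (∀ i, finrank F (X i) = 4) ∧
      ∀ i i', i ≠ i' → finrank F (X i ⊓ X i' : Submodule F _) ≤ 2 := by
  obtain ⟨P, hP, hdisj, hinj⟩ := exists_parallelism F
  have hW : finrank F (Fin (8 - 4) → F) = 4 := finrank_fin_fun F
  choose f hf using fun x : Fin (Fintype.card F ^ 2 + Fintype.card F + 1) ×
    Fin (Fintype.card F ^ 2 + 1) × Fin (Fintype.card F ^ 2 + 1) =>
      exists_spreadSet hW (P x.1 x.2.1) (P x.1 x.2.2) (hP _ _) (hP _ _)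
  let Y := fun x : (Fin (Fintype.card F ^ 2 + Fintype.card F + 1) × Fin (Fintype.card F ^ 2 + 1) ×
    Fin (Fintype.card F ^ 2 + 1)) × Fin (Fintype.card F ^ 2) =>
      cosetSubspace (P x.1.1 x.1.2.1) (P x.1.1 x.1.2.2) (f x.1 x.2)
  have hYY (x x') (h : x ≠ x') : finrank F (Y x ⊓ Y x' : Submodule F _) ≤ 2 := by
    obtain ⟨⟨k, j, l⟩, m⟩ := x
    obtain ⟨⟨k', j', l'⟩, m'⟩ := x'
    have hle := finrank_cosetSubspace_inf_le (P k j) (P k' j') (P k l) (P k' l')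
      (f (k, j, l) m) (f (k', j', l') m')
    by_cases hk : k = k'
    · subst hk
      by_cases hj : j = j'
      · subst hj
        by_cases hl : l = l'
        · subst hl
          have hm : m ≠ m' := fun hm => h (by rw [hm])
          exact (finrank_cosetSubspace_inf_le_of_disjoint _ _ _ _ (hf _ m m' hm)).trans_eq (hP k l)
        · refine hle.trans_eq ?_
          rw [hdisj k l l' hl, inf_idem, hP, finrank_bot]
      · refine hle.trans ?_
        rw [hdisj k j j' hj, finrank_bot, zero_add]
        exact (Submodule.finrank_mono inf_le_left).trans_eq (hP k l)
    · have h1 := finrank_inf_le_one (hP k j) (hP k' j') fun e => hk (hinj _ _ _ _ e)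
      have h2 := finrank_inf_le_one (hP k l) (hP k' l') fun e => hk (hinj _ _ _ _ e)
      exact hle.trans (add_le_add h1 h2)
  have hAY (A : C) (x) : finrank F (A.1.vecMulLinear.graph ⊓ Y x : Submodule F _) ≤ 2 :=
    (finrank_graph_inf_cosetSubspace_le _ _ _ _).trans_eq (hP _ _)
  have hYZ (x) : finrank F (Y x ⊓ LinearMap.range (LinearMap.inr F (Fin 4 → F) _) :
      Submodule F _) ≤ 2 :=
    (finrank_cosetSubspace_inf_range_inr_le _ _ _).trans_eq (hP _ _)
  have hAZ (A : C) : finrank F (A.1.vecMulLinear.graph ⊓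
      LinearMap.range (LinearMap.inr F (Fin 4 → F) _) : Submodule F _) ≤ 2 := by
    rw [graph_inf_range_inr, finrank_bot]
    exact Nat.zero_le _
  refine ⟨Sum.elim (fun A => A.1.vecMulLinear.graph)
    (Sum.elim Y fun _ => LinearMap.range (LinearMap.inr F _ _)), fun _ => rfl, ?_, ?_⟩
  · rintro (A | x | _)
    · exact (finrank_graph _).trans (finrank_fin_fun F)
    · exact (finrank_cosetSubspace _ _ _).trans (by rw [hP, hP])
    · exact (LinearMap.finrank_range_of_inj LinearMap.inr_injective).trans hW
  · rintro (A | x | _) (A' | x' | _) h <;> simp only [Sum.elim_inl, Sum.elim_inr]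
    · exact (finrank_graph_inf_graph_le _ _).trans (hC.finrank_ker_vecMulLinear_sub_le A.2 A'.2
        fun e => h (congrArg _ (Subtype.ext e)))
    · exact hAY A x'
    · exact hAZ A
    · exact inf_comm (Y x) _ ▸ hAY A' x
    · exact hYY x x' fun e => h (by rw [e])
    · exact hYZ x
    · exact inf_comm A'.1.vecMulLinear.graph _ ▸ hAZ A'
    · exact inf_comm (Y x') _ ▸ hYZ x'
    · exact absurd rfl h

theorem ncard_le_Aq {F : Type} [Field F] [Finite F] {n d k : ℕ} {S : Set (Submodule F (Fin n → F))}
    (hS : ∀ X ∈ S, finrank F X = k)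
    (hd : ∀ X ∈ S, ∀ Y ∈ S, X ≠ Y → d ≤ subDist F X Y) : S.ncard ≤ Aq F n d k := by
  have : Finite (Submodule F (Fin n → F)) := Finite.of_injective _ SetLike.coe_injective
  refine le_csSup ⟨Nat.card (Submodule F (Fin n → F)), ?_⟩ ⟨S, S.toFinite, rfl, hS, hd⟩
  rintro _ ⟨T, -, rfl, -⟩
  exact Set.ncard_le_card T

/-- For every prime power `q` there is an `(8, M, 4, 4)_q` constant dimension
code with `M = q¹² + Gauss[4,2]_q (q²+1) q² + 1` containing an `(8,4,2)_q` lifted MRD code;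
in particular `A_q(8,4,4) ≥ M`. -/
theorem stmt15 (q : ℕ) (hq : Fintype.card F = q) :
    (∃ (C : Submodule F (Matrix (Fin 4) (Fin (8 - 4)) F))
      (S : Set (Submodule F (Fin 8 → F))),
      IsMRD F 8 4 2 C ∧ liftedCode F 8 4 C ⊆ S ∧ S.Finite ∧
      S.ncard = q ^ 12 + gaussNat F 4 2 * (q ^ 2 + 1) * q ^ 2 + 1 ∧
      (∀ X ∈ S, finrank F X = 4) ∧
      (∀ X ∈ S, ∀ Y ∈ S, X ≠ Y → 4 ≤ subDist F X Y)) ∧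
    q ^ 12 + gaussNat F 4 2 * (q ^ 2 + 1) * q ^ 2 + 1 ≤ Aq F 8 4 4 := by
  obtain ⟨C, hC⟩ := exists_isMRD F
  obtain ⟨X, hgraph, hrank, hinf⟩ := exists_family F hC
  let Z := fun i => (X i).map ((splitEquiv F).symm : _ →ₗ[F] (Fin 8 → F))
  have hZrank (i) : finrank F (Z i) = 4 := (LinearEquiv.finrank_map_eq _ _).trans (hrank i)
  have hZinf (i i') (h : i ≠ i') : finrank F (Z i ⊓ Z i' : Submodule F _) ≤ 2 :=
    (finrank_map_inf_map _ _ _).trans_le (hinf i i' h)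
  have hZinj : Function.Injective Z := by
    intro i i' h
    by_contra hne
    have := hZinf i i' hne
    rw [h, inf_idem, hZrank] at this
    omega
  have hcardC : Nat.card C = q ^ 12 := by
    rw [Module.natCard_eq_pow_finrank (K := F), hC.1, Nat.card_eq_fintype_card, hq]
  have hcard : (Set.range Z).ncard = q ^ 12 + gaussNat F 4 2 * (q ^ 2 + 1) * q ^ 2 + 1 := by
    rw [← Nat.card_coe_set_eq, Nat.card_range_of_injective hZinj, gaussNat,
      card_finrank_two (finrank_fin_fun F), Nat.card_sum, Nat.card_sum, hcardC]
    simp only [Nat.card_prod, Nat.card_fin, Nat.card_unique, hq]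
    ring
  have hSrank : ∀ Y ∈ Set.range Z, finrank F Y = 4 := by
    rintro _ ⟨i, rfl⟩
    exact hZrank i
  have hSdist : ∀ Y ∈ Set.range Z, ∀ Y' ∈ Set.range Z, Y ≠ Y' → 4 ≤ subDist F Y Y' := by
    rintro _ ⟨i, rfl⟩ _ ⟨i', rfl⟩ h
    have := hZinf i i' fun e => h (by rw [e])
    rw [subDist, hZrank, hZrank]
    omega
  refine ⟨⟨C, Set.range Z, hC, ?_, Set.toFinite _, hcard, hSrank, hSdist⟩,
    hcard ▸ ncard_le_Aq hSrank hSdist⟩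
  rintro _ ⟨A, hA, rfl⟩
  exact ⟨Sum.inl ⟨A, hA⟩, by simp only [Z, hgraph, liftSubspace_eq_map_graph]⟩
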